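/- Let n ≥ 2, c_0, c_1, ..., c_N real constants with N ≥ 2, c_1, c_2 nonzero, and p_1, ..., p_N distinct points in ℝ^{n+1}. Then φ(x) = c_0 + Σ_{j=1}^N c_j / |x − p_j|^{n−1} is harmonic on ℝ^{n+1} \ {p_1,...,p_N}, but there exist points where the bracket {φ, |grad φ|²}_{j,k} := (∂_j φ)(∂_k |grad φ|²) − (∂_k φ)(∂_j |grad φ|²) is nonzero for some 1 ≤ j < k ≤ n+1 (i.e., φ is not a solution of the reduced Yang–Mills equation). -/

import Mathlib

/-- The Laplacian `Δφ(x) = ∑_i ∂_i^2 φ(x)` on Euclidean space. -/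
noncomputable def lap {d : ℕ} (φ : EuclideanSpace ℝ (Fin d) → ℝ)
    (x : EuclideanSpace ℝ (Fin d)) : ℝ :=
  ∑ i, fderiv ℝ (fun y => fderiv ℝ φ y (EuclideanSpace.single i 1)) x
    (EuclideanSpace.single i 1)

section

open scoped RealInnerProductSpace Topology
variable {E : Type*} [NormedAddCommGroup E] [InnerProductSpace ℝ E]

theorem hasFDerivAt_inv_norm_pow (k : ℕ) {y : E} (hy : y ≠ 0) :
    HasFDerivAt (fun z : E => (‖z‖ ^ k)⁻¹) (-(k * (‖y‖ ^ (k + 2))⁻¹) • innerSL ℝ y) y := by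
  have hn : ‖y‖ ≠ 0 := norm_ne_zero_iff.mpr hy
  have h1 : HasFDerivAt (fun z : E => ‖z‖) (‖y‖⁻¹ • innerSL ℝ y) y := by
    have h := ((hasFDerivAt_id y).norm_sq).sqrt (by simpa using hn)
    simp only [id, Real.sqrt_sq (norm_nonneg _)] at h
    convert h using 1
    ext v
    simp
    field_simp
  have h2 := ((hasDerivAt_pow k ‖y‖).inv (pow_ne_zero k hn)).comp_hasFDerivAt y h1
  refine h2.congr_fderiv ?_
  rw [smul_smul]
  congr 1
  rcases k with _ | k
  · simp
  · simp
    field_simp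
    ring

/-- The gradient of `y ↦ 1 / ‖y‖ ^ m`. -/
noncomputable def poleGrad (m : ℕ) (y : E) : E := -((m : ℝ) * (‖y‖ ^ (m + 2))⁻¹) • y

/-- The Hessian of `y ↦ 1 / ‖y‖ ^ m`. -/
noncomputable def poleHess (m : ℕ) (y : E) : E →L[ℝ] E :=
  -((m : ℝ) * (‖y‖ ^ (m + 2))⁻¹) • ContinuousLinearMap.id ℝ E +
    ((m : ℝ) * (m + 2) * (‖y‖ ^ (m + 4))⁻¹) • (innerSL ℝ y).smulRight y

theorem poleHess_apply (m : ℕ) (y v : E) :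
    poleHess m y v = -((m : ℝ) * (‖y‖ ^ (m + 2))⁻¹) • v +
      ((m : ℝ) * (m + 2) * (‖y‖ ^ (m + 4))⁻¹ * ⟪y, v⟫) • y := by
  simp [poleHess, smul_smul]

theorem hasFDerivAt_poleGrad (m : ℕ) {y : E} (hy : y ≠ 0) :
    HasFDerivAt (poleGrad m) (poleHess m y) y := by
  have h := (((hasFDerivAt_inv_norm_pow (m + 2) hy).const_mul (m : ℝ)).neg).smul (hasFDerivAt_id y)
  refine h.congr_fderiv ?_
  ext v
  simp [poleHess_apply, smul_smul]
  congr 1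
  ring

theorem contDiffAt_poleGrad (m : ℕ) {y : E} (hy : y ≠ 0) :
    ContDiffAt ℝ ⊤ (poleGrad (E := E) m) y := by
  have h : ContDiffAt ℝ ⊤ (fun z : E => ‖z‖) y := contDiffAt_norm ℝ hy
  have h' := (h.pow (m + 2)).inv (pow_ne_zero _ (norm_ne_zero_iff.mpr hy))
  exact ((contDiffAt_const.mul h').neg).smul contDiffAt_id

theorem trace_poleHess (m : ℕ) (y : EuclideanSpace ℝ (Fin (m + 2))) (hy : y ≠ 0) :
    ∑ i, ⟪poleHess m y (EuclideanSpace.single i 1), EuclideanSpace.single i 1⟫ = 0 := by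
  have hn : ‖y‖ ≠ 0 := norm_ne_zero_iff.mpr hy
  have h : ∑ i, y i * y i = ‖y‖ ^ 2 := by
    rw [EuclideanSpace.real_norm_sq_eq]; simp [sq]
  simp [poleHess_apply, inner_add_left, inner_smul_left,
    EuclideanSpace.inner_single_right, Finset.sum_add_distrib, mul_assoc, ← Finset.mul_sum, h]
  field_simp
  ring

theorem poleHess_symm (m : ℕ) (y v w : E) : ⟪poleHess m y v, w⟫ = ⟪poleHess m y w, v⟫ := by
  simp only [poleHess_apply, inner_add_left, inner_smul_left, real_inner_comm v w]
  simp
  ring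

theorem continuousAt_poleHess (m : ℕ) {y : E} (hy : y ≠ 0) :
    ContinuousAt (poleHess (E := E) m) y := by
  have hn : ‖y‖ ≠ 0 := norm_ne_zero_iff.mpr hy
  have h (k : ℕ) : ContinuousAt (fun z : E => (‖z‖ ^ k)⁻¹) y :=
    (hasFDerivAt_inv_norm_pow k hy).continuousAt
  have h3 : Continuous fun z : E => (innerSL ℝ z).smulRight z :=
    ((ContinuousLinearMap.smulRightL ℝ E E).continuous.comp (innerSL ℝ).continuous).clm_apply
      continuous_id
  unfold poleHess
  exact (((h _).const_mul _).neg.smul continuousAt_const).add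
    (((h _).const_mul _).smul h3.continuousAt)

theorem add_mul_nonpos_of_mul_eq (m : ℕ) {q t β S T A r α γ C : ℝ} (hS : S = T + r)
    (hT : T = A * t) (ht : 0 < t) (ht1 : t ≤ 1) (hC : 0 < C) (hTC : 10 * C ≤ |T|)
    (hrC : |r| ≤ C) (hαC : |α| ≤ C) (hγC : |γ| ≤ C * q) (hq0 : 0 ≤ q) (hqC : q ≤ C ^ 2)
    (key : β * (S ^ 2 - q) = S * (q * α - γ - (m + 2) * A * q)) :
    q + 2 * t * β ≤ 0 := by
  obtain ⟨a, ha⟩ : ∃ a, a = |T| := ⟨_, rfl⟩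
  rw [← ha] at hTC
  have ha2 : T ^ 2 = a ^ 2 := by rw [ha, sq_abs]
  have hrT : |r * T| ≤ a ^ 2 / 10 := by
    rw [abs_mul, ← ha]
    calc |r| * a ≤ (a / 10) * a := by gcongr <;> linarith
      _ = a ^ 2 / 10 := by ring
  obtain ⟨hrT1, hrT2⟩ := abs_le.mp hrT
  have hr2 : r ^ 2 ≤ C ^ 2 := sq_le_sq' (abs_le.mp hrC).1 (abs_le.mp hrC).2
  have hCa : C ^ 2 ≤ a ^ 2 / 100 := by
    have := pow_le_pow_left₀ hC.le (by linarith : C ≤ a / 10) 2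
    linarith [div_pow a 10 2]
  have ha0 : 0 < a ^ 2 := by linarith [pow_pos hC 2]
  have hST : 0 ≤ S * T := by rw [hS]; linarith [sq_nonneg r]
  have hSq : 0 < S ^ 2 - q := by rw [hS]; linarith [sq_nonneg r]
  have hSa : |S| ≤ 11 / 10 * a := by
    rw [hS]; exact (abs_add_le T r).trans (by linarith)
  have hE : t * (S * (q * α - γ)) ≤ 22 / 100 * a ^ 2 * q := by
    have h1 : |q * α - γ| ≤ 2 * C * q := by
      have : q * |α| ≤ q * C := by gcongr
      refine (abs_sub _ _).trans ?_
      rw [abs_mul, abs_of_nonneg hq0]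
      linarith
    calc t * (S * (q * α - γ)) ≤ |t * (S * (q * α - γ))| := le_abs_self _
      _ = t * (|S| * |q * α - γ|) := by rw [abs_mul, abs_mul, abs_of_pos ht]
      _ ≤ 1 * ((11 / 10 * a) * (2 * C * q)) := by gcongr; linarith
      _ ≤ 22 / 100 * a ^ 2 * q := by
        have : C * (a * q) ≤ a / 10 * (a * q) := by
          have : 0 ≤ a := by linarith
          gcongr
          linarith
        linarith
  have hprod : (q + 2 * t * β) * (S ^ 2 - q) ≤ 0 := by
    have h1 : (q + 2 * t * β) * (S ^ 2 - q) =
        q * (S ^ 2 - q) + 2 * (t * (S * (q * α - γ))) - 2 * (m + 2) * (S * T) * q := by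
      rw [add_mul, mul_assoc (2 * t), key, hT]; ring
    have h2 : 4 * ((S * T) * q) ≤ 2 * (m + 2) * (S * T) * q := by
      have : 0 ≤ (m : ℝ) * ((S * T) * q) := by positivity
      linarith
    have h3 : S ^ 2 - 4 * (S * T) + 44 / 100 * a ^ 2 ≤ 0 := by rw [hS]; linarith [sq_nonneg r]
    rw [h1]
    have h4 := mul_nonpos_of_nonpos_of_nonneg h3 hq0
    linarith [mul_nonneg hq0 hq0]
  exact nonpos_of_mul_nonpos_left hprod hSq

/-- Pointwise estimate along a ray `t ↦ t • u`: the square of the tangential part of `G`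
decays at least like `1 / t`. -/
theorem tangential_decay {u G : E} {D : E →L[ℝ] E} {A T t C : ℝ} (m : ℕ) (hu : ‖u‖ = 1)
    (hD : ∀ v w, ⟪D v, w⟫ = ⟪D w, v⟫) (hC : 0 < C) (hGC : ‖G‖ ≤ C) (hDC : ‖D‖ ≤ C)
    (ht : 0 < t) (ht1 : t ≤ 1) (hT : T = A * t) (hTC : 10 * C ≤ |T|)
    (hpar : ∀ a b, ⟪T • u + G, a⟫ *
        ⟪D (T • u + G) + A • (T • u + G) - ((m + 2) * A * ⟪u, T • u + G⟫) • u, b⟫ =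
      ⟪T • u + G, b⟫ *
        ⟪D (T • u + G) + A • (T • u + G) - ((m + 2) * A * ⟪u, T • u + G⟫) • u, a⟫) :
    (‖G‖ ^ 2 - ⟪G, u⟫ ^ 2) + t * (2 * ⟪G, D u⟫ - 2 * ⟪G, u⟫ * ⟪D u, u⟫) ≤ 0 := by
  obtain ⟨w, hw⟩ : ∃ w, w = G - ⟪G, u⟫ • u := ⟨_, rfl⟩
  obtain ⟨r, hr⟩ : ∃ r, r = ⟪G, u⟫ := ⟨_, rfl⟩
  have huu : ⟪u, u⟫ = 1 := by rw [real_inner_self_eq_norm_sq, hu]; norm_num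
  have hwu : ⟪w, u⟫ = 0 := by
    rw [hw, inner_sub_left, inner_smul_left, huu]; simp
  have hG : G = r • u + w := by rw [hw, hr]; abel
  have hrC : |r| ≤ C := by
    rw [hr]; exact (abs_real_inner_le_norm G u).trans (by rw [hu, mul_one]; exact hGC)
  have huw : ⟪u, w⟫ = 0 := by rw [real_inner_comm, hwu]
  set q := ⟪w, w⟫ with hq
  have hq0 : 0 ≤ q := real_inner_self_nonneg
  have hGq : ‖G‖ ^ 2 = r ^ 2 + q := by
    rw [← real_inner_self_eq_norm_sq, hG]
    simp only [inner_add_left, inner_add_right, inner_smul_left, inner_smul_right, huu, hwu, huw]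
    simp [hq]
    ring
  have hqC : q ≤ C ^ 2 := by nlinarith [norm_nonneg G, sq_nonneg r]
  obtain ⟨α, hα⟩ : ∃ α, α = ⟪D u, u⟫ := ⟨_, rfl⟩
  obtain ⟨β, hβ⟩ : ∃ β, β = ⟪D u, w⟫ := ⟨_, rfl⟩
  obtain ⟨γ, hγ⟩ : ∃ γ, γ = ⟪D w, w⟫ := ⟨_, rfl⟩
  have hβ' : ⟪D w, u⟫ = β := by rw [hβ, hD]
  have hαC : |α| ≤ C := by
    rw [hα]
    calc |⟪D u, u⟫| ≤ ‖D u‖ * ‖u‖ := abs_real_inner_le_norm _ _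
      _ ≤ ‖D‖ * ‖u‖ * ‖u‖ := by gcongr; exact D.le_opNorm u
      _ ≤ C := by rw [hu]; simpa using hDC
  have hγC : |γ| ≤ C * q := by
    rw [hγ]
    calc |⟪D w, w⟫| ≤ ‖D w‖ * ‖w‖ := abs_real_inner_le_norm _ _
      _ ≤ ‖D‖ * ‖w‖ * ‖w‖ := by gcongr; exact D.le_opNorm w
      _ ≤ C * ‖w‖ * ‖w‖ := by gcongr
      _ = C * q := by rw [hq, real_inner_self_eq_norm_sq]; ring
  obtain ⟨S, hS⟩ : ∃ S, S = T + r := ⟨_, rfl⟩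
  have hgS : T • u + G = S • u + w := by rw [hG, hS, add_smul, add_assoc]
  have key := hpar u w
  rw [hgS] at key
  simp only [map_add, map_smul, inner_add_left, inner_sub_left, inner_add_right, inner_smul_left,
    inner_smul_right, huu, hwu, huw, ← hα, ← hβ, ← hγ, hβ', ← hq] at key
  simp at key
  have goal' : ⟪G, D u⟫ = r * α + β := by
    rw [hG, inner_add_left, inner_smul_left, real_inner_comm (D u) u,
      real_inner_comm (D u) w, hα, hβ]
    simp
  have hGu : ⟪G, u⟫ = r := by
    rw [hG, inner_add_left, inner_smul_left, huu, hwu]; simp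
  rw [goal', hGq, hGu, ← hα]
  have key' : β * (S ^ 2 - q) = S * (q * α - γ - (m + 2) * A * q) := by linarith
  linarith [add_mul_nonpos_of_mul_eq m hS hT ht ht1 hC hTC hrC hαC hγC hq0 hqC key']

theorem tangential_eq_zero_of_parallel {m : ℕ} (hm : 1 ≤ m) {c : ℝ} (hc : c ≠ 0) {p : E}
    {G : E → E} {D : E → E →L[ℝ] E} (hG : ∀ᶠ x in 𝓝 p, HasFDerivAt G (D x) x)
    (hDsymm : ∀ x v w, ⟪D x v, w⟫ = ⟪D x w, v⟫) (hDcont : ContinuousAt D p)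
    (hpar : ∀ᶠ x in 𝓝[≠] p, ∀ a b,
      ⟪c • poleGrad m (x - p) + G x, a⟫ *
        ⟪(c • poleHess m (x - p) + D x) (c • poleGrad m (x - p) + G x), b⟫ =
      ⟪c • poleGrad m (x - p) + G x, b⟫ *
        ⟪(c • poleHess m (x - p) + D x) (c • poleGrad m (x - p) + G x), a⟫) :
    ∀ᶠ x in 𝓝 p, ‖x - p‖ ^ 2 • G x - ⟪G x, x - p⟫ • (x - p) = 0 := by
  obtain ⟨C, hC⟩ : ∃ C, C = ‖G p‖ + ‖D p‖ + 1 := ⟨_, rfl⟩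
  have hC0 : 0 < C := by rw [hC]; positivity
  have hGC : ∀ᶠ x in 𝓝 p, ‖G x‖ < C :=
    hG.self_of_nhds.continuousAt.norm.eventually_lt_const (by rw [hC]; linarith [norm_nonneg (D p)])
  have hDC : ∀ᶠ x in 𝓝 p, ‖D x‖ < C :=
    hDcont.norm.eventually_lt_const (by rw [hC]; linarith [norm_nonneg (G p)])
  rw [eventually_nhdsWithin_iff] at hpar
  obtain ⟨ρ, hρ, hball⟩ := Metric.eventually_nhds_iff.mp (hG.and (hGC.and (hDC.and hpar)))
  obtain ⟨δ, hδ⟩ : ∃ δ, δ = min ρ (min 1 (|c| / (10 * C))) := ⟨_, rfl⟩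
  have hδ0 : 0 < δ := by rw [hδ]; positivity
  have hδρ : δ ≤ ρ := hδ ▸ min_le_left _ _
  have hδ1 : δ ≤ 1 := hδ ▸ (min_le_right _ _).trans (min_le_left _ _)
  have hδc : δ ≤ |c| / (10 * C) := hδ ▸ (min_le_right _ _).trans (min_le_right _ _)
  refine Metric.eventually_nhds_iff.mpr ⟨δ, hδ0, fun {x} hx => ?_⟩
  rcases eq_or_ne x p with rfl | hxp
  · simp
  obtain ⟨s, hs⟩ : ∃ s, s = ‖x - p‖ := ⟨_, rfl⟩
  have hs0 : 0 < s := by rw [hs]; exact norm_sub_pos_iff.mpr hxp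
  have hsδ : s < δ := by rwa [hs, ← dist_eq_norm]
  obtain ⟨u, hu⟩ : ∃ u, u = s⁻¹ • (x - p) := ⟨_, rfl⟩
  have hunorm : ‖u‖ = 1 := by
    rw [hu, norm_smul, ← hs, norm_inv, Real.norm_of_nonneg hs0.le, inv_mul_cancel₀ hs0.ne']
  have hsu : x - p = s • u := by rw [hu, smul_smul, mul_inv_cancel₀ hs0.ne', one_smul]
  have hxu : x = p + s • u := by rw [← hsu]; abel
  have hdist (t : ℝ) (ht0 : 0 ≤ t) (ht : t ≤ s) : dist (p + t • u) p < ρ := by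
    rw [dist_eq_norm, add_sub_cancel_left, norm_smul, hunorm, Real.norm_of_nonneg ht0]
    linarith
  have hline (t : ℝ) (ht0 : 0 ≤ t) (ht : t ≤ s) :
      HasDerivAt (fun t : ℝ => G (p + t • u)) (D (p + t • u) u) t := by
    have h1 : HasDerivAt (fun t : ℝ => p + t • u) u t := by
      simpa using ((hasDerivAt_id t).smul_const u).const_add p
    exact (hball (hdist t ht0 ht)).1.comp_hasDerivAt t h1
  obtain ⟨Q, hQ⟩ : ∃ Q : ℝ → ℝ, Q = fun t => t * (‖G (p + t • u)‖ ^ 2 - ⟪G (p + t • u), u⟫ ^ 2) :=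
    ⟨_, rfl⟩
  have hQd (t : ℝ) (ht0 : 0 ≤ t) (ht : t ≤ s) : HasDerivAt Q
      ((‖G (p + t • u)‖ ^ 2 - ⟪G (p + t • u), u⟫ ^ 2) + t * (2 * ⟪G (p + t • u), D (p + t • u) u⟫ -
        2 * ⟪G (p + t • u), u⟫ * ⟪D (p + t • u) u, u⟫)) t := by
    have h := hline t ht0 ht
    have h2 := (hasDerivAt_id t).mul (h.norm_sq.sub ((h.inner ℝ (hasDerivAt_const t u)).pow 2))
    rw [hQ]
    refine h2.congr_deriv ?_
    simp
  have hanti : AntitoneOn Q (Set.Icc 0 s) := by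
    refine antitoneOn_of_deriv_nonpos (convex_Icc 0 s)
      (fun t ht => (hQd t ht.1 ht.2).continuousAt.continuousWithinAt) ?_ ?_
    · rw [interior_Icc]
      exact fun t ht => (hQd t ht.1.le ht.2.le).differentiableAt.differentiableWithinAt
    · rw [interior_Icc]
      rintro t ⟨ht0, hts⟩
      rw [(hQd t ht0.le hts.le).deriv]
      obtain ⟨-, h1, h2, h3⟩ := hball (hdist t ht0.le hts.le)
      have hne : p + t • u ≠ p := by
        intro h
        have : t • u = 0 := by simpa using h
        have := congrArg norm this
        simp [norm_smul, hunorm, ht0.ne'] at this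
      replace h3 := h3 hne
      have hnt : ‖t • u‖ = t := by rw [norm_smul, hunorm, mul_one, Real.norm_of_nonneg ht0.le]
      have hg : c • poleGrad m (t • u) = (-(c * m * (t ^ (m + 2))⁻¹) * t) • u := by
        simp only [poleGrad, hnt, smul_smul]
        congr 1; ring
      have hH (v : E) : c • poleHess m (t • u) v = (-(c * m * (t ^ (m + 2))⁻¹)) • v -
          ((m + 2) * (-(c * m * (t ^ (m + 2))⁻¹)) * ⟪u, v⟫) • u := by
        simp only [poleHess_apply, hnt, smul_smul, smul_add, inner_smul_left, sub_eq_add_neg,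
          ← neg_smul]
        congr 2
        · ring
        · simp
          field_simp
          ring
      refine tangential_decay (A := -(c * m * (t ^ (m + 2))⁻¹)) m hunorm (hDsymm _) hC0 h1.le h2.le
        ht0 (by linarith) rfl ?_ ?_
      · have e : -(c * m * (t ^ (m + 2))⁻¹) * t = -(c * m * (t ^ (m + 1))⁻¹) := by
          field_simp
          ring
        rw [e, abs_neg, abs_mul, abs_mul, Nat.abs_cast,
          abs_of_pos (by positivity : 0 < (t ^ (m + 1))⁻¹)]
        have h4 : t ^ (m + 1) ≤ t := pow_le_of_le_one ht0.le (by linarith) (by omega)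
        have h5 : t⁻¹ ≤ (t ^ (m + 1))⁻¹ := inv_anti₀ (by positivity) h4
        have h6 : (1 : ℝ) ≤ m := by exact_mod_cast hm
        have h7 : t ≤ |c| / (10 * C) := by linarith
        rw [le_div_iff₀ (by positivity)] at h7
        calc 10 * C = (t * (10 * C)) * t⁻¹ := by field_simp
          _ ≤ |c| * t⁻¹ := by gcongr
          _ ≤ |c| * 1 * (t ^ (m + 1))⁻¹ := by rw [mul_one]; gcongr
          _ ≤ |c| * m * (t ^ (m + 1))⁻¹ := by gcongr
      · intro a b
        have := h3 a b
        simp only [add_sub_cancel_left, add_apply,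
          smul_apply, hH, hg] at this
        convert this using 3 <;> abel
  have hle : Q s ≤ Q 0 := hanti ⟨le_rfl, hs0.le⟩ ⟨hs0.le, le_rfl⟩ hs0.le
  simp only [hQ, zero_mul, ← hxu] at hle
  have hle' := nonpos_of_mul_nonpos_right hle hs0
  have huu : ⟪u, u⟫ = 1 := by rw [real_inner_self_eq_norm_sq, hunorm]; norm_num
  have hw : G x - ⟪G x, u⟫ • u = 0 := by
    rw [← norm_eq_zero, ← sq_eq_zero_iff]
    refine le_antisymm ?_ (sq_nonneg _)
    rw [norm_sub_sq_real, inner_smul_right, norm_smul, hunorm, mul_one, Real.norm_eq_abs, sq_abs]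
    linarith
  calc _ = s ^ 2 • (G x - ⟪G x, u⟫ • u) := by
        rw [← hs, hsu, inner_smul_right, smul_sub, smul_smul, smul_smul]
        congr 2; ring
    _ = 0 := by rw [hw, smul_zero]

theorem exists_orthogonal_unit (hE : 1 < Module.rank ℝ E) (e : E) :
    ∃ v : E, ‖v‖ = 1 ∧ ⟪e, v⟫ = 0 := by
  have h : (ℝ ∙ e)ᗮ ≠ ⊥ := by
    rw [Ne, Submodule.orthogonal_eq_bot_iff]
    intro h
    have := rank_span_le (R := ℝ) {e}
    rw [h, rank_top, Cardinal.mk_singleton] at this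
    exact this.not_gt hE
  obtain ⟨w, hw, hw0⟩ := Submodule.exists_mem_ne_zero_of_ne_bot h
  refine ⟨‖w‖⁻¹ • w, norm_smul_inv_norm hw0, ?_⟩
  rw [inner_smul_right, Submodule.mem_orthogonal_singleton_iff_inner_right.mp hw, mul_zero]

section Superposition

variable {ι : Type*} (m : ℕ) (c : ι → ℝ) (p : ι → E) (s : Finset ι)

/-- The gradient of `x ↦ ∑ i ∈ s, c i / ‖x - p i‖ ^ m`. -/
noncomputable def polesGrad (x : E) : E := ∑ i ∈ s, c i • poleGrad m (x - p i)

/-- The Hessian of `x ↦ ∑ i ∈ s, c i / ‖x - p i‖ ^ m`. -/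
noncomputable def polesHess (x : E) : E →L[ℝ] E := ∑ i ∈ s, c i • poleHess m (x - p i)

variable {m c p s}

theorem hasFDerivAt_sum_poles (c₀ : ℝ) {x : E} (hx : ∀ i ∈ s, x ≠ p i) :
    HasFDerivAt (fun y => c₀ + ∑ i ∈ s, c i / ‖y - p i‖ ^ m) (innerSL ℝ (polesGrad m c p s x))
      x := by
  have h : ∀ i ∈ s, HasFDerivAt (fun y => c i / ‖y - p i‖ ^ m)
      (c i • innerSL ℝ (poleGrad m (x - p i))) x := by
    intro i hi
    have h1 := ((hasFDerivAt_inv_norm_pow m (sub_ne_zero.mpr (hx i hi))).comp x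
      ((hasFDerivAt_id x).sub_const (p i))).const_mul (c i)
    simp only [div_eq_mul_inv]
    refine h1.congr_fderiv ?_
    ext v
    simp [poleGrad]
  refine ((HasFDerivAt.fun_sum h).const_add c₀).congr_fderiv ?_
  simp [polesGrad]

theorem hasFDerivAt_polesGrad {x : E} (hx : ∀ i ∈ s, x ≠ p i) :
    HasFDerivAt (polesGrad m c p s) (polesHess m c p s x) x := by
  refine HasFDerivAt.fun_sum fun i hi => ?_
  have h := ((hasFDerivAt_poleGrad m (sub_ne_zero.mpr (hx i hi))).comp x
    ((hasFDerivAt_id x).sub_const (p i))).const_smul (c i)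
  exact h.congr_fderiv (by ext; simp)

theorem polesHess_symm (x v w : E) :
    ⟪polesHess m c p s x v, w⟫ = ⟪polesHess m c p s x w, v⟫ := by
  simp only [polesHess, sum_apply, smul_apply, sum_inner, inner_smul_left]
  exact Finset.sum_congr rfl fun i _ => by rw [poleHess_symm]

theorem continuousAt_polesHess {x : E} (hx : ∀ i ∈ s, x ≠ p i) :
    ContinuousAt (polesHess m c p s) x := by
  refine tendsto_finsetSum _ fun i hi => ?_
  exact ((continuousAt_poleHess m (sub_ne_zero.mpr (hx i hi))).comp
    (f := fun x => x - p i) (by fun_prop)).const_smul (c i)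

theorem contDiffAt_polesGrad {x : E} (hx : ∀ i ∈ s, x ≠ p i) :
    ContDiffAt ℝ ⊤ (polesGrad m c p s) x := by
  refine ContDiffAt.sum fun i hi => contDiffAt_const.smul ?_
  exact (contDiffAt_poleGrad m (sub_ne_zero.mpr (hx i hi))).comp x
    (contDiffAt_id.sub contDiffAt_const)

theorem eventually_ne_poles {X : Type*} [TopologicalSpace X] [T1Space X] {p : ι → X} {x : X}
    (hx : ∀ i ∈ s, x ≠ p i) :
    ∀ᶠ y in 𝓝 x, ∀ i ∈ s, y ≠ p i :=
  (Filter.eventually_all_finset s).mpr fun i hi => isOpen_ne.mem_nhds (hx i hi)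

theorem trace_polesHess {p : ι → EuclideanSpace ℝ (Fin (m + 2))}
    {x : EuclideanSpace ℝ (Fin (m + 2))}
    (hx : ∀ i ∈ s, x ≠ p i) :
    ∑ k, ⟪polesHess m c p s x (EuclideanSpace.single k 1), EuclideanSpace.single k 1⟫ = 0 := by
  simp only [polesHess, sum_apply, smul_apply, sum_inner, inner_smul_left]
  rw [Finset.sum_comm]
  refine Finset.sum_eq_zero fun i hi => ?_
  rw [← Finset.mul_sum, trace_poleHess m _ (sub_ne_zero.mpr (hx i hi)), mul_zero]

/-- The gradient and its image under the Hessian cannot be parallel everywhere. -/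
theorem not_parallel_polesGrad [DecidableEq ι] (hE : 1 < Module.rank ℝ E) (hm : 1 ≤ m)
    (hp : Set.InjOn p s) {i₀ i₁ : ι} (hi₀ : i₀ ∈ s) (hi₁ : i₁ ∈ s) (hne : i₀ ≠ i₁)
    (hc₀ : c i₀ ≠ 0) (hc₁ : c i₁ ≠ 0) :
    ∃ x, (∀ i ∈ s, x ≠ p i) ∧ ∃ a b,
      ⟪polesGrad m c p s x, a⟫ * ⟪polesHess m c p s x (polesGrad m c p s x), b⟫ ≠
        ⟪polesGrad m c p s x, b⟫ * ⟪polesHess m c p s x (polesGrad m c p s x), a⟫ := by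
  by_contra! hpar
  have hp₀ : ∀ i ∈ s.erase i₀, p i₀ ≠ p i := fun i hi h =>
    Finset.ne_of_mem_erase hi (hp hi₀ (Finset.mem_of_mem_erase hi) h).symm
  obtain ⟨F, hF⟩ : ∃ F : E → E, F = fun x => ‖x - p i₀‖ ^ 2 • polesGrad m c p (s.erase i₀) x -
      ⟪polesGrad m c p (s.erase i₀) x, x - p i₀⟫ • (x - p i₀) := ⟨_, rfl⟩
  have hev : ∀ᶠ x in 𝓝 (p i₀), F x = 0 := by
    rw [hF]
    refine tangential_eq_zero_of_parallel hm hc₀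
      ((eventually_ne_poles hp₀).mono fun x hx => hasFDerivAt_polesGrad hx)
      polesHess_symm (continuousAt_polesHess hp₀) ?_
    rw [eventually_nhdsWithin_iff]
    filter_upwards [eventually_ne_poles hp₀] with x hx hxp a b
    have hxs : ∀ i ∈ s, x ≠ p i := fun i hi => by
      rcases eq_or_ne i i₀ with rfl | h
      · exact hxp
      · exact hx i (Finset.mem_erase.mpr ⟨h, hi⟩)
    have := hpar x hxs a b
    rwa [polesGrad, polesHess, ← Finset.add_sum_erase _ _ hi₀, ← Finset.add_sum_erase _ _ hi₀]
      at this
  have hzero : Set.EqOn F 0 (p '' (s.erase i₀))ᶜ := by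
    refine AnalyticOnNhd.eqOn_of_preconnected_of_eventuallyEq (𝕜 := ℝ) (fun x hx => ?_)
      analyticOnNhd_const
      (Set.Countable.isConnected_compl_of_one_lt_rank hE
        ((s.erase i₀).finite_toSet.image p).countable).isPreconnected (z₀ := p i₀) ?_ hev
    · have hx' : ∀ i ∈ s.erase i₀, x ≠ p i := fun i hi h => hx ⟨i, hi, h.symm⟩
      have h1 := contDiffAt_polesGrad (m := m) (c := c) hx'
      have h2 : ContDiffAt ℝ ⊤ (fun y => y - p i₀) x := contDiffAt_id.sub contDiffAt_const
      rw [hF]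
      exact (((h2.norm_sq ℝ).smul h1).sub ((h1.inner ℝ h2).smul h2)).analyticAt
    · rintro ⟨i, hi, h⟩
      exact hp₀ i hi h.symm
  obtain ⟨e, he⟩ : ∃ e, e = p i₁ - p i₀ := ⟨_, rfl⟩
  have hi₁' : i₁ ∈ s.erase i₀ := Finset.mem_erase.mpr ⟨hne.symm, hi₁⟩
  have he0 : e ≠ 0 := by rw [he, sub_ne_zero]; exact (hp₀ i₁ hi₁').symm
  obtain ⟨v, hv, hev'⟩ := exists_orthogonal_unit hE e
  have hvv : ⟪v, v⟫ = 1 := by rw [real_inner_self_eq_norm_sq, hv]; norm_num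
  have hp₁ : ∀ i ∈ (s.erase i₀).erase i₁, p i₁ ≠ p i := fun i hi h =>
    Finset.ne_of_mem_erase hi (hp hi₁ (Finset.mem_of_mem_erase (Finset.mem_of_mem_erase hi)) h).symm
  obtain ⟨G, hG⟩ : ∃ G, G = polesGrad m c p ((s.erase i₀).erase i₁) := ⟨_, rfl⟩
  have hline : ContinuousAt (fun t : ℝ => p i₁ + t • v) 0 := by fun_prop
  have hGc : ContinuousAt (fun t : ℝ => G (p i₁ + t • v)) 0 := by
    refine ContinuousAt.comp (g := G) ?_ hline
    rw [hG]; simpa using (hasFDerivAt_polesGrad hp₁).continuousAt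
  obtain ⟨R, hR⟩ : ∃ R : ℝ → ℝ, R = fun t => -(c i₁ * m * ‖e‖ ^ 2) + t ^ (m + 1) *
    ((‖e‖ ^ 2 + t ^ 2) * ⟪G (p i₁ + t • v), v⟫ - t * ⟪G (p i₁ + t • v), e + t • v⟫) := ⟨_, rfl⟩
  have hRc : ContinuousAt R 0 := by
    rw [hR]
    have h1 : ContinuousAt (fun t : ℝ => ⟪G (p i₁ + t • v), v⟫) 0 := hGc.inner continuousAt_const
    have h2 : ContinuousAt (fun t : ℝ => ⟪G (p i₁ + t • v), e + t • v⟫) 0 :=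
      hGc.inner (by fun_prop)
    fun_prop
  have hR0 : R 0 = -(c i₁ * m * ‖e‖ ^ 2) := by simp [hR]
  have hRz : ∀ᶠ t in 𝓝[>] (0 : ℝ), R t = 0 := by
    have hev : ∀ᶠ t in 𝓝 (0 : ℝ), ∀ i ∈ (s.erase i₀).erase i₁, p i₁ + t • v ≠ p i :=
      hline.eventually (eventually_ne_poles (by simpa using hp₁))
    filter_upwards [hev.filter_mono nhdsWithin_le_nhds, self_mem_nhdsWithin] with t ht ht0
    replace ht0 : 0 < t := ht0
    have hnt : ‖t • v‖ = t := by rw [norm_smul, hv, mul_one, Real.norm_of_nonneg ht0.le]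
    have hx : p i₁ + t • v ∈ (p '' (s.erase i₀))ᶜ := by
      rintro ⟨i, hi, h⟩
      rcases eq_or_ne i i₁ with rfl | hii
      · rw [left_eq_add] at h
        rw [h, norm_zero] at hnt
        exact ht0.ne hnt
      · exact ht i (Finset.mem_erase.mpr ⟨hii, hi⟩) h.symm
    have h := congrArg (fun y => ⟪y, v⟫) (hzero hx)
    have hsub : p i₁ + t • v - p i₀ = e + t • v := by rw [he]; abel
    have hnorm : ‖e + t • v‖ ^ 2 = ‖e‖ ^ 2 + t ^ 2 := by
      rw [norm_add_sq_real, hnt, inner_smul_right, hev']; ring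
    have hgrad : polesGrad m c p (s.erase i₀) (p i₁ + t • v) =
        (-(c i₁ * m * (t ^ (m + 2))⁻¹) * t) • v + G (p i₁ + t • v) := by
      rw [hG, polesGrad, ← Finset.add_sum_erase _ _ hi₁', add_sub_cancel_left, poleGrad, hnt,
        smul_smul, smul_smul]
      congr 2
      ring
    simp only [hF, hsub, hnorm, hgrad, Pi.zero_apply, inner_zero_left, inner_sub_left,
      inner_add_left, inner_smul_left, inner_smul_right, inner_add_right, hvv, hev',
      real_inner_comm e v, conj_trivial] at h
    have ht' : t ^ (m + 1) * (t ^ (m + 2))⁻¹ * t = 1 := by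
      field_simp
      ring
    rw [hR]
    simp only [inner_add_right, inner_smul_right]
    linear_combination t ^ (m + 1) * h + c i₁ * m * ‖e‖ ^ 2 * ht'
  have hR' : R 0 = 0 :=
    tendsto_nhds_unique (hRc.tendsto.mono_left nhdsWithin_le_nhds)
      (tendsto_const_nhds.congr' (hRz.mono fun t ht => ht.symm))
  rw [hR0, neg_eq_zero] at hR'
  have : (m : ℝ) ≠ 0 := by exact_mod_cast (by omega : m ≠ 0)
  simp_all

end Superposition

theorem inner_mul_inner_comm_of_coord {d : ℕ} {g h : EuclideanSpace ℝ (Fin d)}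
    (hgh : ∀ j k : Fin d, j < k → g j * h k = g k * h j) (a b : EuclideanSpace ℝ (Fin d)) :
    ⟪g, a⟫ * ⟪h, b⟫ = ⟪g, b⟫ * ⟪h, a⟫ := by
  have hall (j k : Fin d) : g j * h k = g k * h j := by
    rcases lt_trichotomy j k with hjk | rfl | hjk
    · exact hgh j k hjk
    · rfl
    · exact (hgh k j hjk).symm
  simp only [PiLp.inner_apply, Finset.sum_mul_sum]
  rw [Finset.sum_comm]
  refine Finset.sum_congr rfl fun k _ => Finset.sum_congr rfl fun j _ => ?_
  simp only [RCLike.inner_apply, conj_trivial]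
  linear_combination a j * b k * hall j k

section Coordinates

variable {d m : ℕ} {ι : Type*} {c : ι → ℝ} {p : ι → EuclideanSpace ℝ (Fin d)} {s : Finset ι}
  {x : EuclideanSpace ℝ (Fin d)}

theorem fderiv_sum_poles (c₀ : ℝ) (hx : ∀ i ∈ s, x ≠ p i) (k : Fin d) :
    fderiv ℝ (fun y => c₀ + ∑ i ∈ s, c i / ‖y - p i‖ ^ m) x (EuclideanSpace.single k 1) =
      polesGrad m c p s x k := by
  rw [(hasFDerivAt_sum_poles c₀ hx).fderiv]
  simp [EuclideanSpace.inner_single_right]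

theorem fderiv_normSq_grad_sum_poles (c₀ : ℝ) (hx : ∀ i ∈ s, x ≠ p i) (k : Fin d) :
    fderiv ℝ (fun y => ∑ l, (fderiv ℝ (fun z => c₀ + ∑ i ∈ s, c i / ‖z - p i‖ ^ m) y
      (EuclideanSpace.single l 1)) ^ 2) x (EuclideanSpace.single k 1) =
      2 * polesHess m c p s x (polesGrad m c p s x) k := by
  have h : (fun y => ∑ l, (fderiv ℝ (fun z => c₀ + ∑ i ∈ s, c i / ‖z - p i‖ ^ m) y
      (EuclideanSpace.single l 1)) ^ 2) =ᶠ[𝓝 x] fun y => ‖polesGrad m c p s y‖ ^ 2 := by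
    filter_upwards [eventually_ne_poles hx] with y hy
    rw [EuclideanSpace.real_norm_sq_eq]
    exact Finset.sum_congr rfl fun l _ => by rw [fderiv_sum_poles c₀ hy]
  rw [h.fderiv_eq, (hasFDerivAt_polesGrad hx).norm_sq.fderiv]
  have := polesHess_symm (m := m) (c := c) (p := p) (s := s) x (EuclideanSpace.single k 1)
    (polesGrad m c p s x)
  rw [real_inner_comm] at this
  simp [this, EuclideanSpace.inner_single_right]

theorem lap_sum_poles (c₀ : ℝ) {p : ι → EuclideanSpace ℝ (Fin (m + 2))}
    {x : EuclideanSpace ℝ (Fin (m + 2))} (hx : ∀ i ∈ s, x ≠ p i) :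
    lap (fun y => c₀ + ∑ i ∈ s, c i / ‖y - p i‖ ^ m) x = 0 := by
  rw [lap, ← trace_polesHess (c := c) hx]
  refine Finset.sum_congr rfl fun k _ => ?_
  have h : (fun y => fderiv ℝ (fun y => c₀ + ∑ i ∈ s, c i / ‖y - p i‖ ^ m) y
      (EuclideanSpace.single k 1)) =ᶠ[𝓝 x]
      fun y => ⟪polesGrad m c p s y, EuclideanSpace.single k 1⟫ := by
    filter_upwards [eventually_ne_poles hx] with y hy
    rw [fderiv_sum_poles c₀ hy]
    simp [EuclideanSpace.inner_single_right]
  rw [h.fderiv_eq, ((hasFDerivAt_polesGrad hx).inner ℝ (hasFDerivAt_const _ x)).fderiv]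
  simp

end Coordinates

end

/-- The `N`-soliton `φ(x) = c₀ + ∑ⱼ cⱼ/|x−pⱼ|^{n−1}` (`N ≥ 2`, `c₁, c₂ ≠ 0`, distinct poles)
is harmonic away from the poles, but its bracket `{φ, |grad φ|²}_{j,k}` does not vanish
identically. -/
theorem Nsoliton_harmonic_not_YangMills (n N : ℕ) (hn : 2 ≤ n) (hN : 2 ≤ N)
    (c₀ : ℝ) (c : Fin N → ℝ)
    (hc1 : c ⟨0, by omega⟩ ≠ 0) (hc2 : c ⟨1, by omega⟩ ≠ 0)
    (p : Fin N → EuclideanSpace ℝ (Fin (n + 1))) (hp : Function.Injective p) :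
    (∀ x : EuclideanSpace ℝ (Fin (n + 1)), x ∉ Set.range p →
      lap (fun y => c₀ + ∑ j, c j / ‖y - p j‖ ^ (n - 1)) x = 0) ∧
    (∃ x : EuclideanSpace ℝ (Fin (n + 1)), x ∉ Set.range p ∧
      ∃ j k : Fin (n + 1), j < k ∧
        (fderiv ℝ (fun y => c₀ + ∑ i, c i / ‖y - p i‖ ^ (n - 1)) x
            (EuclideanSpace.single j 1)) *
          (fderiv ℝ (fun y => ∑ l, (fderiv ℝ
              (fun z => c₀ + ∑ i, c i / ‖z - p i‖ ^ (n - 1)) y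
              (EuclideanSpace.single l 1)) ^ 2) x (EuclideanSpace.single k 1))
        - (fderiv ℝ (fun y => c₀ + ∑ i, c i / ‖y - p i‖ ^ (n - 1)) x
            (EuclideanSpace.single k 1)) *
          (fderiv ℝ (fun y => ∑ l, (fderiv ℝ
              (fun z => c₀ + ∑ i, c i / ‖z - p i‖ ^ (n - 1)) y
              (EuclideanSpace.single l 1)) ^ 2) x (EuclideanSpace.single j 1)) ≠ 0) := by
  obtain ⟨m, rfl⟩ : ∃ m, n = m + 1 := ⟨n - 1, by omega⟩
  simp only [Nat.add_sub_cancel]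
  refine ⟨fun x hx => lap_sum_poles c₀ fun i _ h => hx ⟨i, h.symm⟩, ?_⟩
  obtain ⟨x, hx, a, b, hab⟩ := not_parallel_polesGrad (m := m) (c := c) (s := Finset.univ)
    (by rw [← Module.finrank_eq_rank, finrank_euclideanSpace_fin]; exact_mod_cast (by omega))
    (by omega) hp.injOn (Finset.mem_univ (⟨0, by omega⟩ : Fin N))
    (Finset.mem_univ (⟨1, by omega⟩ : Fin N)) (by simp) hc1 hc2
  refine ⟨x, fun ⟨i, hi⟩ => hx i (Finset.mem_univ i) hi.symm, ?_⟩
  by_contra! hbr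
  refine hab (inner_mul_inner_comm_of_coord (fun j k hjk => ?_) a b)
  have := hbr j k hjk
  simp only [fderiv_normSq_grad_sum_poles c₀ hx, fderiv_sum_poles c₀ hx] at this
  linarith
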